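/- Let p ≥ 5 be a prime and let I₁ be the pro-p Iwahori subgroup of SL₂(ℤ_p), i.e. the subgroup of matrices A ∈ SL₂(ℤ_p) with A₀₀ − 1 ∈ pℤ_p, A₁₁ − 1 ∈ pℤ_p and A₁₀ ∈ pℤ_p. The map φ : I₁ → (ℤ/pℤ) × (ℤ/pℤ) sending A to (A₀₁ mod p, (p⁻¹·A₁₀) mod p) is a surjective group homomorphism whose kernel is {A ∈ I₁ : A₀₁ ∈ pℤ_p and A₁₀ ∈ p²ℤ_p}, and this kernel equals the topological closure of the commutator subgroup of I₁. Consequently the quotient of I₁ by the closure of its commutator subgroup is isomorphic to (ℤ/pℤ) × (ℤ/pℤ). -/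

import Mathlib

open Matrix

/-- The pro-`p` Iwahori subgroup of `SL₂(ℤ_p)`: matrices that are upper-triangular
unipotent mod `p`. -/
def proPIwahori (p : ℕ) [Fact p.Prime] : Subgroup (Matrix.SpecialLinearGroup (Fin 2) ℤ_[p]) where
  carrier := {A | (p : ℤ_[p]) ∣ ((A : Matrix (Fin 2) (Fin 2) ℤ_[p]) 0 0 - 1) ∧
    (p : ℤ_[p]) ∣ ((A : Matrix (Fin 2) (Fin 2) ℤ_[p]) 1 1 - 1) ∧
    (p : ℤ_[p]) ∣ ((A : Matrix (Fin 2) (Fin 2) ℤ_[p]) 1 0)}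
  one_mem' := by
    simp [Matrix.SpecialLinearGroup.coe_one, Matrix.one_apply]
  mul_mem' := by
    rintro A B ⟨hA1, hA2, hA3⟩ ⟨hB1, hB2, hB3⟩
    simp only [Set.mem_setOf_eq, Matrix.SpecialLinearGroup.coe_mul, Matrix.mul_apply,
      Fin.sum_univ_two] at *
    refine ⟨?_, ?_, ?_⟩
    · have h : (A : Matrix (Fin 2) (Fin 2) ℤ_[p]) 0 0 * (B : Matrix (Fin 2) (Fin 2) ℤ_[p]) 0 0 +
          (A : Matrix (Fin 2) (Fin 2) ℤ_[p]) 0 1 * (B : Matrix (Fin 2) (Fin 2) ℤ_[p]) 1 0 - 1 =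
          ((A : Matrix (Fin 2) (Fin 2) ℤ_[p]) 0 0 - 1) * (B : Matrix (Fin 2) (Fin 2) ℤ_[p]) 0 0 +
          ((B : Matrix (Fin 2) (Fin 2) ℤ_[p]) 0 0 - 1) +
          (A : Matrix (Fin 2) (Fin 2) ℤ_[p]) 0 1 * (B : Matrix (Fin 2) (Fin 2) ℤ_[p]) 1 0 := by
        ring
      rw [h]
      exact dvd_add (dvd_add (hA1.mul_right _) hB1) (hB3.mul_left _)
    · have h : (A : Matrix (Fin 2) (Fin 2) ℤ_[p]) 1 0 * (B : Matrix (Fin 2) (Fin 2) ℤ_[p]) 0 1 +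
          (A : Matrix (Fin 2) (Fin 2) ℤ_[p]) 1 1 * (B : Matrix (Fin 2) (Fin 2) ℤ_[p]) 1 1 - 1 =
          (A : Matrix (Fin 2) (Fin 2) ℤ_[p]) 1 0 * (B : Matrix (Fin 2) (Fin 2) ℤ_[p]) 0 1 +
          ((A : Matrix (Fin 2) (Fin 2) ℤ_[p]) 1 1 - 1) * (B : Matrix (Fin 2) (Fin 2) ℤ_[p]) 1 1 +
          ((B : Matrix (Fin 2) (Fin 2) ℤ_[p]) 1 1 - 1) := by
        ring
      rw [h]
      exact dvd_add (dvd_add (hA3.mul_right _) (hA2.mul_right _)) hB2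
    · exact dvd_add (hA3.mul_right _) (hB3.mul_left _)
  inv_mem' := by
    rintro A ⟨hA1, hA2, hA3⟩
    rw [Matrix.SpecialLinearGroup.SL2_inv_expl]
    refine ⟨?_, ?_, ?_⟩ <;> simp [hA1, hA2, hA3]

variable (p : ℕ) [Fact p.Prime]

/-- The topology on `SL₂(ℤ_p)`, as a subspace of the `2 × 2` matrices over `ℤ_p`. -/
noncomputable instance : TopologicalSpace (Matrix.SpecialLinearGroup (Fin 2) ℤ_[p]) :=
  inferInstanceAs (TopologicalSpace {A : Matrix (Fin 2) (Fin 2) ℤ_[p] // A.det = 1})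

namespace Matrix.SpecialLinearGroup

open scoped commutatorElement

variable {R : Type*} [CommRing R]

/-- The upper unipotent matrix with off-diagonal entry `x`. -/
def upperUnipotent (x : R) : SpecialLinearGroup (Fin 2) R := ⟨!![1, x; 0, 1], by simp⟩

/-- The lower unipotent matrix with off-diagonal entry `x`. -/
def lowerUnipotent (x : R) : SpecialLinearGroup (Fin 2) R := ⟨!![1, 0; x, 1], by simp⟩

/-- The diagonal matrix with entries `u` and `u⁻¹`. -/
def diagUnit (u : Rˣ) : SpecialLinearGroup (Fin 2) R := ⟨!![(u : R), 0; 0, ↑u⁻¹], by simp⟩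

@[simp]
theorem coe_upperUnipotent (x : R) :
    (upperUnipotent x : Matrix (Fin 2) (Fin 2) R) = !![1, x; 0, 1] := rfl

@[simp]
theorem coe_lowerUnipotent (x : R) :
    (lowerUnipotent x : Matrix (Fin 2) (Fin 2) R) = !![1, 0; x, 1] := rfl

@[simp]
theorem coe_diagUnit (u : Rˣ) :
    (diagUnit u : Matrix (Fin 2) (Fin 2) R) = !![(u : R), 0; 0, ↑u⁻¹] := rfl

theorem commutator_diagUnit_upperUnipotent (u : Rˣ) (x : R) :
    ⁅diagUnit u, upperUnipotent x⁆ = upperUnipotent (((u : R) ^ 2 - 1) * x) := by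
  rw [commutatorElement_def, mul_inv_eq_iff_eq_mul, mul_inv_eq_iff_eq_mul]
  ext i j
  fin_cases i <;> fin_cases j <;> simp
  linear_combination -((u : R) * x) * u.mul_inv

theorem commutator_diagUnit_lowerUnipotent (u : Rˣ) (x : R) :
    ⁅diagUnit u⁻¹, lowerUnipotent x⁆ = lowerUnipotent (((u : R) ^ 2 - 1) * x) := by
  rw [commutatorElement_def, mul_inv_eq_iff_eq_mul, mul_inv_eq_iff_eq_mul]
  ext i j
  fin_cases i <;> fin_cases j <;> simp
  linear_combination -((u : R) * x) * u.mul_inv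

theorem eq_lowerUnipotent_mul_diagUnit_mul_upperUnipotent (A : SpecialLinearGroup (Fin 2) R)
    (u : Rˣ) (hu : A.1 0 0 = u) :
    A = lowerUnipotent (A.1 1 0 * ↑u⁻¹) * diagUnit u * upperUnipotent (A.1 0 1 * ↑u⁻¹) := by
  have hdet : (u : R) * A.1 1 1 - A.1 0 1 * A.1 1 0 = 1 := by
    rw [← hu, ← det_fin_two, A.2]
  ext i j
  fin_cases i <;> fin_cases j <;> simp [hu]
  · linear_combination -(A.1 0 1) * u.mul_inv
  · linear_combination (↑u⁻¹ : R) * hdet - A.1 1 1 * u.mul_inv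

theorem commutator_upperUnipotent_lowerUnipotent_coe (x : R) :
    (⁅upperUnipotent (1 : R), lowerUnipotent x⁆ : SpecialLinearGroup (Fin 2) R).1 =
      !![1 + x + x ^ 2, -x; x ^ 2, 1 - x] := by
  rw [commutatorElement_def, coe_mul, coe_mul, coe_mul, coe_inv, coe_inv,
    coe_upperUnipotent, coe_lowerUnipotent, adjugate_fin_two_of, adjugate_fin_two_of]
  ext i j
  fin_cases i <;> fin_cases j <;> simp <;> ring

end Matrix.SpecialLinearGroup

namespace PadicInt

variable {p}

theorem toZMod_eq_zero_iff_dvd (x : ℤ_[p]) : toZMod x = 0 ↔ (p : ℤ_[p]) ∣ x := by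
  rw [← RingHom.mem_ker, ker_toZMod, maximalIdeal_eq_span_p, Ideal.mem_span_singleton]

theorem toZMod_eq_one_iff_dvd (x : ℤ_[p]) : toZMod x = 1 ↔ (p : ℤ_[p]) ∣ x - 1 := by
  rw [← toZMod_eq_zero_iff_dvd, map_sub, map_one, sub_eq_zero]

theorem isUnit_iff_not_dvd (x : ℤ_[p]) : IsUnit x ↔ ¬ (p : ℤ_[p]) ∣ x := by
  rw [← norm_lt_one_iff_dvd, ← not_isUnit_iff, not_not]

theorem isUnit_of_dvd_sub_one {x : ℤ_[p]} (h : (p : ℤ_[p]) ∣ x - 1) : IsUnit x := by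
  rw [isUnit_iff_not_dvd, ← toZMod_eq_zero_iff_dvd, (toZMod_eq_one_iff_dvd x).2 h]
  exact one_ne_zero

theorem isClosed_setOf_pow_dvd (n : ℕ) : IsClosed {x : ℤ_[p] | (p : ℤ_[p]) ^ n ∣ x} := by
  simp_rw [← Ideal.mem_span_singleton, ← norm_le_pow_iff_mem_span_pow]
  exact isClosed_le continuous_norm continuous_const

theorem exists_add_sq_eq_of_dvd {w : ℤ_[p]} (hw : (p : ℤ_[p]) ∣ w) :
    ∃ z : ℤ_[p], (p : ℤ_[p]) ∣ z ∧ z + z ^ 2 = w := by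
  rw [← norm_lt_one_iff_dvd] at hw
  let F : Polynomial ℤ_[p] := Polynomial.X + Polynomial.X ^ 2 - Polynomial.C w
  obtain ⟨z, hz, hz', -⟩ := hensels_lemma (F := F) (a := (0 : ℤ_[p])) (by simpa [F] using hw)
  refine ⟨z, ?_, ?_⟩
  · rw [← norm_lt_one_iff_dvd]
    simpa [F] using hz'
  · simpa [F, sub_eq_zero] using hz

theorem exists_unit_sq_sub_one_dvd (hp : p ≠ 2) :
    ∃ u : ℤ_[p]ˣ, (p : ℤ_[p]) ∣ u - 1 ∧
      ∀ x : ℤ_[p], (p : ℤ_[p]) * x ∈ Set.range fun w ↦ ((u : ℤ_[p]) ^ 2 - 1) * w := by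
  obtain ⟨u, hu⟩ := isUnit_of_dvd_sub_one (p := p) (x := 1 + p) (by simp)
  have h2 : IsUnit (2 + p : ℤ_[p]) := by
    rw [isUnit_iff_not_dvd, ← toZMod_eq_zero_iff_dvd, map_add, map_ofNat, map_natCast,
      ZMod.natCast_self, add_zero, ← Nat.cast_ofNat, ZMod.natCast_eq_zero_iff]
    exact fun h ↦ hp ((Nat.prime_dvd_prime_iff_eq Fact.out Nat.prime_two).1 h)
  obtain ⟨v, hv⟩ := h2
  refine ⟨u, by simp [hu], fun x ↦ ⟨↑v⁻¹ * x, ?_⟩⟩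
  simp only [hu]
  linear_combination (p * x : ℤ_[p]) * v.mul_inv - (p * x * ↑v⁻¹ : ℤ_[p]) * hv

end PadicInt

namespace proPIwahori

open PadicInt Matrix.SpecialLinearGroup
open scoped commutatorElement

variable {p}

theorem upperUnipotent_mem (x : ℤ_[p]) : upperUnipotent x ∈ proPIwahori p :=
  ⟨by simp, by simp, by simp⟩

theorem lowerUnipotent_mem {x : ℤ_[p]} (hx : (p : ℤ_[p]) ∣ x) :
    lowerUnipotent x ∈ proPIwahori p :=
  ⟨by simp, by simp, by simpa using hx⟩

theorem diagUnit_mem {u : ℤ_[p]ˣ} (hu : (p : ℤ_[p]) ∣ u - 1) : diagUnit u ∈ proPIwahori p := by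
  refine ⟨by simpa using hu, ?_, by simp⟩
  have h : (↑u⁻¹ - 1 : ℤ_[p]) = -↑u⁻¹ * (u - 1) := by
    linear_combination u.inv_mul
  rw [coe_diagUnit]
  simpa only [of_apply, cons_val_one, cons_val_fin_one, cons_val', h] using hu.mul_left _

theorem upperUnipotent_mem_commutator (hp : p ≠ 2) {x : ℤ_[p]} (hx : (p : ℤ_[p]) ∣ x) :
    upperUnipotent x ∈ ⁅proPIwahori p, proPIwahori p⁆ := by
  obtain ⟨y, rfl⟩ := hx
  obtain ⟨u, hu, h⟩ := exists_unit_sq_sub_one_dvd hp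
  obtain ⟨w, hw⟩ := h y
  rw [← hw, ← commutator_diagUnit_upperUnipotent]
  exact Subgroup.commutator_mem_commutator (diagUnit_mem hu) (upperUnipotent_mem w)

theorem lowerUnipotent_mem_commutator (hp : p ≠ 2) {x : ℤ_[p]} (hx : (p : ℤ_[p]) ^ 2 ∣ x) :
    lowerUnipotent x ∈ ⁅proPIwahori p, proPIwahori p⁆ := by
  obtain ⟨y, rfl⟩ := hx
  obtain ⟨u, hu, h⟩ := exists_unit_sq_sub_one_dvd hp
  obtain ⟨w, hw⟩ := h y
  have hw' : (p : ℤ_[p]) ^ 2 * y = ((u : ℤ_[p]) ^ 2 - 1) * (p * w) := by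
    linear_combination -(p : ℤ_[p]) * hw
  have hmem := inv_mem (diagUnit_mem hu)
  have hinv : (diagUnit u)⁻¹ = diagUnit u⁻¹ := by
    rw [SL2_inv_expl]
    ext i j
    fin_cases i <;> fin_cases j <;> simp
  rw [hw', ← commutator_diagUnit_lowerUnipotent]
  exact Subgroup.commutator_mem_commutator (hinv ▸ hmem) (lowerUnipotent_mem (dvd_mul_right _ _))

theorem mem_commutator_iff_diagUnit_mem (hp : p ≠ 2) {A : SpecialLinearGroup (Fin 2) ℤ_[p]}
    {u : ℤ_[p]ˣ} (hu : A.1 0 0 = u) (h01 : (p : ℤ_[p]) ∣ A.1 0 1)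
    (h10 : (p : ℤ_[p]) ^ 2 ∣ A.1 1 0) :
    A ∈ ⁅proPIwahori p, proPIwahori p⁆ ↔ diagUnit u ∈ ⁅proPIwahori p, proPIwahori p⁆ := by
  rw [eq_lowerUnipotent_mul_diagUnit_mul_upperUnipotent A u hu,
    Subgroup.mul_mem_cancel_right _ (upperUnipotent_mem_commutator hp (h01.mul_right _)),
    Subgroup.mul_mem_cancel_left _ (lowerUnipotent_mem_commutator hp (h10.mul_right _))]

theorem diagUnit_mem_commutator (hp : p ≠ 2) {u : ℤ_[p]ˣ} (hu : (p : ℤ_[p]) ∣ u - 1) :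
    diagUnit u ∈ ⁅proPIwahori p, proPIwahori p⁆ := by
  obtain ⟨z, hz, hzu⟩ := exists_add_sq_eq_of_dvd hu
  have hcoe := commutator_upperUnipotent_lowerUnipotent_coe z
  refine (mem_commutator_iff_diagUnit_mem hp (A := ⁅upperUnipotent 1, lowerUnipotent z⁆)
    ?_ ?_ ?_).1 (Subgroup.commutator_mem_commutator (upperUnipotent_mem 1) (lowerUnipotent_mem hz))
  · rw [hcoe]
    simp only [of_apply, cons_val', cons_val_zero]
    linear_combination hzu
  · rw [hcoe]
    simpa using hz
  · rw [hcoe]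
    simpa using pow_dvd_pow_of_dvd hz 2

theorem mem_commutator_of_dvd (hp : p ≠ 2) {A : SpecialLinearGroup (Fin 2) ℤ_[p]}
    (hA : A ∈ proPIwahori p) (h01 : (p : ℤ_[p]) ∣ A.1 0 1) (h10 : (p : ℤ_[p]) ^ 2 ∣ A.1 1 0) :
    A ∈ ⁅proPIwahori p, proPIwahori p⁆ := by
  obtain ⟨u, hu⟩ := isUnit_of_dvd_sub_one hA.1
  exact (mem_commutator_iff_diagUnit_mem hp hu.symm h01 h10).2
    (diagUnit_mem_commutator hp (hu ▸ hA.1))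

/-- The quotient by `p` of the lower left entry of an element of the pro-`p` Iwahori subgroup. -/
noncomputable def lowerLeftDiv (A : proPIwahori p) : ℤ_[p] := A.2.2.2.choose

theorem eq_mul_lowerLeftDiv (A : proPIwahori p) : A.1.1 1 0 = p * lowerLeftDiv A :=
  A.2.2.2.choose_spec

theorem lowerLeftDiv_eq {A : proPIwahori p} {y : ℤ_[p]} (h : A.1.1 1 0 = p * y) :
    lowerLeftDiv A = y :=
  mul_left_cancel₀ (Nat.cast_ne_zero.2 (NeZero.ne p)) ((eq_mul_lowerLeftDiv A).symm.trans h)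

/-- The homomorphism sending `A` to the residues of `A₀₁` and `p⁻¹ A₁₀` modulo `p`. -/
noncomputable def affineRootHom (p : ℕ) [Fact p.Prime] :
    proPIwahori p →* Multiplicative (ZMod p × ZMod p) :=
  MonoidHom.mk' (fun A ↦ .ofAdd (toZMod (A.1.1 0 1), toZMod (lowerLeftDiv A))) fun A B ↦ by
    have hA := (toZMod_eq_one_iff_dvd _).2 A.2.1
    have hA' := (toZMod_eq_one_iff_dvd _).2 A.2.2.1
    have hB := (toZMod_eq_one_iff_dvd _).2 B.2.1
    have hB' := (toZMod_eq_one_iff_dvd _).2 B.2.2.1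
    have h01 : (A * B).1.1 0 1 = A.1.1 0 0 * B.1.1 0 1 + A.1.1 0 1 * B.1.1 1 1 := by
      simp [mul_apply]
    have h10 : lowerLeftDiv (A * B) =
        lowerLeftDiv A * B.1.1 0 0 + A.1.1 1 1 * lowerLeftDiv B := by
      apply lowerLeftDiv_eq
      have : (A * B).1.1 1 0 = A.1.1 1 0 * B.1.1 0 0 + A.1.1 1 1 * B.1.1 1 0 := by
        simp [mul_apply]
      rw [this, eq_mul_lowerLeftDiv A, eq_mul_lowerLeftDiv B]
      ring
    rw [← ofAdd_add, Prod.mk_add_mk, h01, h10]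
    simp only [map_add, map_mul, hA, hA', hB, hB', one_mul, mul_one, add_comm]

theorem affineRootHom_apply (A : proPIwahori p) :
    (affineRootHom p A).toAdd = (toZMod (A.1.1 0 1), toZMod (lowerLeftDiv A)) := rfl

theorem affineRootHom_surjective : Function.Surjective (affineRootHom p) := by
  intro x
  obtain ⟨b, hb⟩ := ZMod.ringHom_surjective (toZMod (p := p)) x.toAdd.1
  obtain ⟨c, hc⟩ := ZMod.ringHom_surjective (toZMod (p := p)) x.toAdd.2
  let U : proPIwahori p := ⟨upperUnipotent b, upperUnipotent_mem b⟩
  let L : proPIwahori p := ⟨lowerUnipotent (p * c), lowerUnipotent_mem (dvd_mul_right _ _)⟩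
  refine ⟨U * L, Multiplicative.toAdd.injective ?_⟩
  have hU : lowerLeftDiv U = 0 := lowerLeftDiv_eq (by simp [U])
  have hL : lowerLeftDiv L = c := lowerLeftDiv_eq (by simp [L])
  rw [map_mul, toAdd_mul, affineRootHom_apply, affineRootHom_apply, hU, hL]
  ext <;> simp [U, L, hb, hc]

theorem affineRootHom_eq_one_iff (A : proPIwahori p) :
    affineRootHom p A = 1 ↔ (p : ℤ_[p]) ∣ A.1.1 0 1 ∧ (p : ℤ_[p]) ^ 2 ∣ A.1.1 1 0 := by
  rw [← toAdd_eq_zero, affineRootHom_apply, Prod.mk_eq_zero, toZMod_eq_zero_iff_dvd,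
    toZMod_eq_zero_iff_dvd, eq_mul_lowerLeftDiv A, pow_two,
    mul_dvd_mul_iff_left (Nat.cast_ne_zero.2 (NeZero.ne p))]

theorem affineRootHom_eq_one_iff_mem_closure (hp : p ≠ 2) (A : proPIwahori p) :
    affineRootHom p A = 1 ↔ (A : SpecialLinearGroup (Fin 2) ℤ_[p]) ∈
      closure ((⁅proPIwahori p, proPIwahori p⁆ : Subgroup _) :
        Set (SpecialLinearGroup (Fin 2) ℤ_[p])) := by
  rw [affineRootHom_eq_one_iff]
  refine ⟨fun h ↦ subset_closure (mem_commutator_of_dvd hp A.2 h.1 h.2), fun h ↦ ?_⟩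
  have hentry (i j : Fin 2) :
      Continuous fun B : SpecialLinearGroup (Fin 2) ℤ_[p] ↦ B.1 i j :=
    continuous_subtype_val.matrix_elem i j
  have hclosed : IsClosed {B : SpecialLinearGroup (Fin 2) ℤ_[p] |
      (p : ℤ_[p]) ^ 1 ∣ B.1 0 1 ∧ (p : ℤ_[p]) ^ 2 ∣ B.1 1 0} :=
    ((isClosed_setOf_pow_dvd 1).preimage (hentry 0 1)).inter
      ((isClosed_setOf_pow_dvd 2).preimage (hentry 1 0))
  have hle : ⁅proPIwahori p, proPIwahori p⁆ ≤ (affineRootHom p).ker.map (proPIwahori p).subtype := by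
    refine Subgroup.commutator_le.2 fun B hB C hC ↦
      ⟨⁅(⟨B, hB⟩ : proPIwahori p), (⟨C, hC⟩ : proPIwahori p)⁆, ?_, rfl⟩
    rw [SetLike.mem_coe, MonoidHom.mem_ker, map_commutatorElement,
      commutatorElement_eq_one_iff_mul_comm, mul_comm]
  have hsub := closure_minimal (fun B hB ↦ ?_) hclosed h
  · exact ⟨pow_one (p : ℤ_[p]) ▸ hsub.1, hsub.2⟩
  · obtain ⟨C, hC, rfl⟩ := hle hB
    have hdvd := (affineRootHom_eq_one_iff C).1 hC
    exact ⟨(pow_one (p : ℤ_[p])).symm ▸ hdvd.1, hdvd.2⟩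

end proPIwahori

/-- Lemma 5.1 of the paper for `G = SL₂(ℚ_p)`: the map `I₁ → (ℤ/pℤ) × (ℤ/pℤ)`,
`A ↦ (A₀₁ mod p, (p⁻¹·A₁₀) mod p)`, is a surjective group homomorphism; its kernel is
`{A ∈ I₁ : A₀₁ ∈ pℤ_p, A₁₀ ∈ p²ℤ_p}`, which equals the topological closure of the
commutator subgroup of `I₁`; consequently the quotient of `I₁` by the closure of its
commutator subgroup is isomorphic to `(ℤ/pℤ) × (ℤ/pℤ)`. -/
theorem abelianization_proPIwahori (p : ℕ) [Fact p.Prime] (hp : 5 ≤ p) :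
    ∃ φ : (proPIwahori p) → ZMod p × ZMod p,
      (∀ (A : proPIwahori p) (y : ℤ_[p]),
        ((A : Matrix.SpecialLinearGroup (Fin 2) ℤ_[p]) : Matrix (Fin 2) (Fin 2) ℤ_[p]) 1 0 =
          (p : ℤ_[p]) * y →
        φ A = (PadicInt.toZMod
            (((A : Matrix.SpecialLinearGroup (Fin 2) ℤ_[p]) : Matrix (Fin 2) (Fin 2) ℤ_[p]) 0 1),
          PadicInt.toZMod y)) ∧
      (∀ A B : proPIwahori p, φ (A * B) = φ A + φ B) ∧
      Function.Surjective φ ∧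
      (∀ A : proPIwahori p, φ A = 0 ↔
        ((p : ℤ_[p]) ∣
            ((A : Matrix.SpecialLinearGroup (Fin 2) ℤ_[p]) : Matrix (Fin 2) (Fin 2) ℤ_[p]) 0 1 ∧
          (p : ℤ_[p]) ^ 2 ∣
            ((A : Matrix.SpecialLinearGroup (Fin 2) ℤ_[p]) : Matrix (Fin 2) (Fin 2) ℤ_[p]) 1 0)) ∧
      (∀ A : proPIwahori p, φ A = 0 ↔
        (A : Matrix.SpecialLinearGroup (Fin 2) ℤ_[p]) ∈
          closure ((⁅proPIwahori p, proPIwahori p⁆ : Subgroup _) :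
            Set (Matrix.SpecialLinearGroup (Fin 2) ℤ_[p]))) ∧
      ∃ ψ : (proPIwahori p) →* Multiplicative (ZMod p × ZMod p),
        Function.Surjective ψ ∧
        ∀ A : proPIwahori p, ψ A = 1 ↔
          (A : Matrix.SpecialLinearGroup (Fin 2) ℤ_[p]) ∈
            closure ((⁅proPIwahori p, proPIwahori p⁆ : Subgroup _) :
              Set (Matrix.SpecialLinearGroup (Fin 2) ℤ_[p])) := by
  have hp2 : p ≠ 2 := by omega
  refine ⟨fun A ↦ (proPIwahori.affineRootHom p A).toAdd, fun A y hy ↦ ?_, fun A B ↦ ?_, ?_,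
    fun A ↦ ?_, fun A ↦ ?_, proPIwahori.affineRootHom p, proPIwahori.affineRootHom_surjective,
    proPIwahori.affineRootHom_eq_one_iff_mem_closure hp2⟩
  · rw [← proPIwahori.lowerLeftDiv_eq hy]
    exact proPIwahori.affineRootHom_apply A
  · simp only [map_mul, toAdd_mul]
  · exact Multiplicative.toAdd.surjective.comp proPIwahori.affineRootHom_surjective
  · rw [toAdd_eq_zero]
    exact proPIwahori.affineRootHom_eq_one_iff A
  · rw [toAdd_eq_zero]
    exact proPIwahori.affineRootHom_eq_one_iff_mem_closure hp2 A
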